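/- arXiv:1702.01288 — 3 statements merged into one kernel-verified Lean document; each statement's English description precedes it below -/
import Mathlib

section
/- Let d ≥ 2 be an integer and let a > 0. Then the integral I_a = ∫_0^a (1 + ((d−1)/2)·coth(s)) · sinh(s)^{d−1} · (∫_s^a sinh(u)^{−(d−1)} du) ds is finite. -/
open Real MeasureTheory

lemma intervalIntegrable_inv_sinh_pow (n : ℕ) {s a : ℝ} (hs : 0 < s) (ha : 0 < a) :
    IntervalIntegrable (fun u : ℝ => (Real.sinh u ^ n)⁻¹) volume s a := by
  refine ContinuousOn.intervalIntegrable (ContinuousOn.inv₀ (by fun_prop) fun u hu => ?_)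
  have hu0 : 0 < u := (lt_min hs ha).trans_le hu.1
  exact (pow_pos (Real.sinh_pos_iff.2 hu0) n).ne'

lemma continuousOn_integral_inv_sinh_pow (n : ℕ) {a : ℝ} (ha : 0 < a) :
    ContinuousOn (fun s : ℝ => ∫ u in s..a, (Real.sinh u ^ n)⁻¹) (Set.Ioi 0) := by
  intro s (hs : 0 < s)
  have hmeas : StronglyMeasurable fun u : ℝ => (Real.sinh u ^ n)⁻¹ :=
    (Real.continuous_sinh.pow n).measurable.inv.stronglyMeasurable
  have hcont : ContinuousAt (fun u : ℝ => (Real.sinh u ^ n)⁻¹) s :=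
    ContinuousAt.inv₀ (by fun_prop) (pow_pos (Real.sinh_pos_iff.2 hs) n).ne'
  exact (intervalIntegral.integral_hasDerivAt_left (intervalIntegrable_inv_sinh_pow n hs ha)
    hmeas.stronglyMeasurableAtFilter hcont).continuousAt.continuousWithinAt

lemma sinh_pow_mul_integral_inv_sinh_pow_succ_le (n : ℕ) {s a : ℝ} (hs : 0 < s) (hsa : s ≤ a) :
    Real.sinh s ^ n * ∫ u in s..a, (Real.sinh u ^ (n + 1))⁻¹ ≤ Real.log (a / s) := by
  have ha : 0 < a := hs.trans_le hsa
  rw [← integral_inv_of_pos hs ha, ← intervalIntegral.integral_const_mul]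
  refine intervalIntegral.integral_mono_on hsa
    ((intervalIntegrable_inv_sinh_pow (n + 1) hs ha).const_mul _) ?_ fun u hu => ?_
  · refine intervalIntegral.intervalIntegrable_inv (fun u hu => ?_) continuousOn_id
    exact ((lt_min hs ha).trans_le hu.1).ne'
  · have hu0 : 0 < u := hs.trans_le hu.1
    have hsu : Real.sinh s ≤ Real.sinh u := Real.sinh_le_sinh.2 hu.1
    have hs' : 0 < Real.sinh s := Real.sinh_pos_iff.2 hs
    have hu' : 0 < Real.sinh u := Real.sinh_pos_iff.2 hu0
    calc Real.sinh s ^ n * (Real.sinh u ^ (n + 1))⁻¹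
        ≤ Real.sinh u ^ n * (Real.sinh u ^ (n + 1))⁻¹ := by gcongr
      _ = (Real.sinh u)⁻¹ := by
        rw [pow_succ]
        field_simp
      _ ≤ u⁻¹ := by
        gcongr
        exact Real.self_le_sinh_iff.2 hu0.le





/-- For `d ≥ 2` and `a > 0`, the Cherny–Engelbert test integral
`I_a = ∫_0^a (1 + ((d-1)/2) coth s) sinh(s)^{d-1} (∫_s^a sinh(u)^{-(d-1)} du) ds` is finite,
i.e. the integrand is Lebesgue integrable on `(0,a)`. -/
theorem stmt_3 (d : ℕ) (hd : 2 ≤ d) (a : ℝ) (ha : 0 < a) :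
    MeasureTheory.IntegrableOn
      (fun s : ℝ =>
        (1 + ((d : ℝ) - 1) / 2 * (Real.cosh s / Real.sinh s)) * Real.sinh s ^ (d - 1) *
          ∫ u in s..a, (Real.sinh u ^ (d - 1))⁻¹)
      (Set.Ioo 0 a) := by
  obtain ⟨n, rfl⟩ : ∃ n, d = n + 2 := ⟨d - 2, by omega⟩
  have hn : n + 2 - 1 = n + 1 := rfl
  have hc : (0 : ℝ) ≤ (((n + 2 : ℕ) : ℝ) - 1) / 2 := by
    push_cast
    linarith [(n.cast_nonneg : (0 : ℝ) ≤ n)]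
  simp only [hn]
  generalize (((n + 2 : ℕ) : ℝ) - 1) / 2 = c at hc ⊢
  have hlog : IntegrableOn
      (fun s : ℝ => (Real.sinh a + c * Real.cosh a) * (Real.log a - Real.log s))
      (Set.Ioo 0 a) := by
    have h : IntervalIntegrable (fun s : ℝ => Real.log a - Real.log s) volume 0 a :=
      intervalIntegrable_const.sub intervalIntegral.intervalIntegrable_log'
    exact (intervalIntegrable_iff_integrableOn_Ioo_of_le ha.le).1 (h.const_mul _)
  refine Integrable.mono' hlog ?_ ?_
  · refine ContinuousOn.aestronglyMeasurable ?_ measurableSet_Ioo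
    refine ContinuousOn.mul (ContinuousOn.mul ?_ (by fun_prop))
      ((continuousOn_integral_inv_sinh_pow (n + 1) ha).mono fun s hs => hs.1)
    refine continuousOn_const.add (continuousOn_const.mul ?_)
    exact Real.continuous_cosh.continuousOn.div Real.continuous_sinh.continuousOn
      fun s hs => (Real.sinh_pos_iff.2 hs.1).ne'
  · filter_upwards [ae_restrict_mem measurableSet_Ioo] with s hs
    have hs' : 0 < Real.sinh s := Real.sinh_pos_iff.2 hs.1
    have hJ : 0 ≤ ∫ u in s..a, (Real.sinh u ^ (n + 1))⁻¹ :=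
      intervalIntegral.integral_nonneg hs.2.le fun u hu =>
        inv_nonneg.2 (pow_nonneg (Real.sinh_nonneg_iff.2 (hs.1.le.trans hu.1)) _)
    have hle := sinh_pow_mul_integral_inv_sinh_pow_succ_le n hs.1 hs.2.le
    rw [Real.log_div ha.ne' hs.1.ne'] at hle
    have hsinh : Real.sinh s ≤ Real.sinh a := Real.sinh_le_sinh.2 hs.2.le
    have hcosh : Real.cosh s ≤ Real.cosh a := by
      rw [Real.cosh_le_cosh, abs_of_pos hs.1, abs_of_pos ha]
      exact hs.2.le
    have hcosh0 := Real.cosh_pos s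
    have hsinh0 : 0 < Real.sinh a := hs'.trans_le hsinh
    have hcosha := Real.cosh_pos a
    rw [Real.norm_of_nonneg (by positivity)]
    calc (1 + c * (Real.cosh s / Real.sinh s)) * Real.sinh s ^ (n + 1) *
          ∫ u in s..a, (Real.sinh u ^ (n + 1))⁻¹
        = (Real.sinh s + c * Real.cosh s) *
          (Real.sinh s ^ n * ∫ u in s..a, (Real.sinh u ^ (n + 1))⁻¹) := by
          rw [pow_succ]
          field_simp
      _ ≤ (Real.sinh a + c * Real.cosh a) * (Real.log a - Real.log s) := by gcongr
end

section
/- Let d ≥ 2 be an integer and let a > 0. Then the integral I_∞ = ∫_a^∞ sinh(s)^{d−1} · (∫_s^∞ sinh(u)^{−(d−1)} du) ds is infinite (equals +∞). -/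
open Real MeasureTheory

lemma sinh_mul_exp_neg_mul_exp_le_sinh {a s : ℝ} (h : a ≤ s) :
    Real.sinh a * Real.exp (-a) * Real.exp s ≤ Real.sinh s := by
  have h₁ : Real.sinh a * Real.exp (-a) * Real.exp s
      = (Real.exp s - Real.exp (s - 2 * a)) / 2 := by
    have e₁ : Real.exp s = Real.exp a * Real.exp (-a) * Real.exp s := by
      rw [← Real.exp_add, add_neg_cancel, Real.exp_zero, one_mul]
    have e₂ : Real.exp (s - 2 * a) = Real.exp (-a) * Real.exp (-a) * Real.exp s := by
      rw [← Real.exp_add, ← Real.exp_add]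
      congr 1
      ring
    rw [Real.sinh_eq, e₂]
    linear_combination (-1 / 2 : ℝ) * e₁
  have h₂ : Real.exp (-s) ≤ Real.exp (s - 2 * a) := Real.exp_le_exp.2 (by linarith)
  rw [h₁, Real.sinh_eq]
  linarith

lemma sinh_le_exp (u : ℝ) : Real.sinh u ≤ Real.exp u := by
  rw [Real.sinh_eq]
  linarith [Real.exp_pos u, Real.exp_pos (-u)]

lemma inv_exp_pow (n : ℕ) (u : ℝ) : (Real.exp u ^ n)⁻¹ = Real.exp (-(n : ℝ) * u) := by
  rw [← Real.exp_nat_mul, ← Real.exp_neg, neg_mul]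

lemma integrableOn_inv_sinh_pow {n : ℕ} (hn : 0 < n) {s : ℝ} (hs : 0 < s) :
    IntegrableOn (fun u ↦ (Real.sinh u ^ n)⁻¹) (Set.Ioi s) := by
  have hk : 0 < Real.sinh s * Real.exp (-s) :=
    mul_pos (Real.sinh_pos_iff.2 hs) (Real.exp_pos _)
  have hneg : -(n : ℝ) < 0 := by simpa using hn
  refine ((integrableOn_exp_mul_Ioi hneg s).const_mul
    (((Real.sinh s * Real.exp (-s)) ^ n)⁻¹)).mono'
    (Real.measurable_sinh.pow_const n).inv.aestronglyMeasurable ?_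
  filter_upwards [ae_restrict_mem measurableSet_Ioi] with u hu
  have hu' : s < u := hu
  have hpos : 0 < Real.sinh u := Real.sinh_pos_iff.2 (hs.trans hu')
  rw [Real.norm_of_nonneg (by positivity), ← inv_exp_pow, ← mul_inv, ← mul_pow]
  gcongr
  exact sinh_mul_exp_neg_mul_exp_le_sinh hu'.le

lemma exp_div_le_integral_inv_sinh_pow {n : ℕ} (hn : 0 < n) {s : ℝ} (hs : 0 < s) :
    (Real.exp s ^ n)⁻¹ / n ≤ ∫ u in Set.Ioi s, (Real.sinh u ^ n)⁻¹ := by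
  have hneg : -(n : ℝ) < 0 := by simpa using hn
  have h := integral_exp_mul_Ioi hneg s
  rw [neg_div_neg_eq, ← inv_exp_pow] at h
  rw [← h]
  refine setIntegral_mono_on (integrableOn_exp_mul_Ioi hneg s)
    (integrableOn_inv_sinh_pow hn hs) measurableSet_Ioi fun u hu ↦ ?_
  have hpos : 0 < Real.sinh u := Real.sinh_pos_iff.2 (hs.trans hu)
  rw [← inv_exp_pow]
  gcongr
  exact sinh_le_exp u

/-- For `d ≥ 2` and `a > 0`, the Cherny–Engelbert test integral
`I_∞ = ∫_a^∞ sinh(s)^{d-1} (∫_s^∞ sinh(u)^{-(d-1)} du) ds` is infinite. -/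
theorem stmt_4 (d : ℕ) (hd : 2 ≤ d) (a : ℝ) (ha : 0 < a) :
    ∫⁻ s in Set.Ioi a,
        ENNReal.ofReal
          (Real.sinh s ^ (d - 1) * ∫ u in Set.Ioi s, (Real.sinh u ^ (d - 1))⁻¹) = ⊤ := by
  have hn : 0 < d - 1 := by omega
  generalize d - 1 = n at hn
  have hk : 0 < Real.sinh a * Real.exp (-a) :=
    mul_pos (Real.sinh_pos_iff.2 ha) (Real.exp_pos _)
  set k := Real.sinh a * Real.exp (-a)
  have hn' : (0 : ℝ) < n := by exact_mod_cast hn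
  have hconst : ∫⁻ _ in Set.Ioi a, ENNReal.ofReal (k ^ n / n) = ⊤ := by
    rw [setLIntegral_const, Real.volume_Ioi, ENNReal.mul_top]
    exact (ENNReal.ofReal_pos.2 (by positivity)).ne'
  rw [eq_top_iff, ← hconst]
  refine setLIntegral_mono' measurableSet_Ioi fun s hs ↦ ENNReal.ofReal_le_ofReal ?_
  have hs' : a < s := hs
  calc k ^ n / n = (k * Real.exp s) ^ n * ((Real.exp s ^ n)⁻¹ / n) := by
        rw [mul_pow k]
        field_simp
    _ ≤ _ := by
        have hpos : 0 < Real.sinh s := Real.sinh_pos_iff.2 (ha.trans hs')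
        gcongr
        · exact sinh_mul_exp_neg_mul_exp_le_sinh hs'.le
        · exact exp_div_le_integral_inv_sinh_pow hn (ha.trans hs')
end

section
/- Let γ > 2 be a real number and let μ be the measure on ℝ³ with Lebesgue density p ↦ (1 + ‖p‖²)^{−(γ+1)/2}, where ‖·‖ is the euclidean norm. Then the pushforward of μ under the map p ↦ p₁/√(1 + ‖p‖²) (the first component of the relativistic velocity) is a measure on ℝ with Lebesgue density v ↦ C · (1 − v²)^{γ/2 − 1} · 1_{(−1,1)}(v) for some constant C > 0; after normalizing μ to a probability measure, the resulting density is (Γ(γ)/(2^{γ−1} Γ(γ/2)²)) · (1 − v²)^{γ/2 − 1} on [−1,1], i.e., a symmetric Beta law on [−1,1] with parameter γ/2. -/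
open Real MeasureTheory

/-- The change of variables `x = a v / √(1 - v²)`, which expresses a momentum component `x` through
the velocity component `v`, the remaining momentum components contributing `a² = 1 + ‖y‖²`. -/
lemma lintegral_velocity_eq {a : ℝ} (ha : 0 < a) (γ : ℝ) (g : ℝ → ENNReal) :
    ∫⁻ x : ℝ, g (x / √(a ^ 2 + x ^ 2)) * ENNReal.ofReal ((a ^ 2 + x ^ 2) ^ (-(γ + 1) / 2)) =
      ENNReal.ofReal (a ^ (-γ)) *
        ∫⁻ v in Set.Ioo (-1 : ℝ) 1, g v * ENNReal.ofReal ((1 - v ^ 2) ^ (γ / 2 - 1)) := by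
  set φ : ℝ → ℝ := fun v => a * v / √(1 - v ^ 2) with hφ
  have hpos : ∀ v ∈ Set.Ioo (-1 : ℝ) 1, 0 < 1 - v ^ 2 := fun v hv => by
    nlinarith [hv.1, hv.2]
  have hsum : ∀ v ∈ Set.Ioo (-1 : ℝ) 1, a ^ 2 + φ v ^ 2 = (a / √(1 - v ^ 2)) ^ 2 := fun v hv => by
    have h := hpos v hv
    simp only [hφ, div_pow, Real.sq_sqrt h.le]
    field_simp
    ring
  have hinv : ∀ v ∈ Set.Ioo (-1 : ℝ) 1, φ v / √(a ^ 2 + φ v ^ 2) = v := fun v hv => by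
    have h := Real.sqrt_pos.2 (hpos v hv)
    rw [hsum v hv, Real.sqrt_sq (by positivity)]
    simp only [hφ]
    field_simp
  have hinj : Set.InjOn φ (Set.Ioo (-1) 1) := fun u hu v hv huv => by
    rw [← hinv u hu, ← hinv v hv, huv]
  have himage : φ '' Set.Ioo (-1) 1 = Set.univ := by
    refine Set.eq_univ_of_forall fun x => ⟨x / √(a ^ 2 + x ^ 2), ?_, ?_⟩
    · have hs : 0 < √(a ^ 2 + x ^ 2) := by positivity
      have hx : |x| < √(a ^ 2 + x ^ 2) := by
        rw [← Real.sqrt_sq_eq_abs]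
        exact Real.sqrt_lt_sqrt (sq_nonneg x) (by nlinarith [pow_pos ha 2])
      rw [Set.mem_Ioo, ← abs_lt, abs_div, abs_of_pos hs, div_lt_one hs]
      exact hx
    · have h : 1 - (x / √(a ^ 2 + x ^ 2)) ^ 2 = (a / √(a ^ 2 + x ^ 2)) ^ 2 := by
        rw [div_pow, div_pow, Real.sq_sqrt (by positivity)]
        field_simp
        ring
      simp only [hφ]
      rw [h, Real.sqrt_sq (by positivity)]
      have hs : 0 < √(a ^ 2 + x ^ 2) := by positivity
      field_simp
  have hderiv : ∀ v ∈ Set.Ioo (-1 : ℝ) 1,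
      HasDerivWithinAt φ (a / √(1 - v ^ 2) ^ 3) (Set.Ioo (-1) 1) v := fun v hv => by
    have h := hpos v hv
    have hs := Real.sqrt_pos.2 h
    have h1 : HasDerivAt (fun v : ℝ => 1 - v ^ 2) (-(2 * v)) v := by
      simpa using (hasDerivAt_pow 2 v).const_sub 1
    have h2 := ((hasDerivAt_id v).const_mul a).div (h1.sqrt h.ne') hs.ne'
    refine (h2.congr_deriv ?_).hasDerivWithinAt
    have hsq := Real.sq_sqrt h.le
    simp only [id]
    field_simp
    rw [hsq]
    ring
  rw [← setLIntegral_univ, ← himage,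
    lintegral_image_eq_lintegral_abs_deriv_mul measurableSet_Ioo hderiv hinj,
    ← lintegral_const_mul' _ _ ENNReal.ofReal_ne_top]
  refine setLIntegral_congr_fun measurableSet_Ioo fun v hv => ?_
  have hs := Real.sqrt_pos.2 (hpos v hv)
  have hweight : |a / √(1 - v ^ 2) ^ 3| * (a ^ 2 + φ v ^ 2) ^ (-(γ + 1) / 2) =
      a ^ (-γ) * (1 - v ^ 2) ^ (γ / 2 - 1) := by
    rw [hsum v hv, abs_of_pos (by positivity)]
    nth_rw 3 [← Real.sq_sqrt (hpos v hv).le]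
    generalize √(1 - v ^ 2) = w at hs
    rw [← Real.rpow_natCast_mul (by positivity), ← Real.rpow_natCast_mul hs.le,
      Real.div_rpow ha.le hs.le, div_mul_div_comm, div_eq_iff (by positivity)]
    have e1 : a * a ^ ((2 : ℕ) * (-(γ + 1) / 2)) = a ^ (-γ) := by
      nth_rw 1 [← Real.rpow_one a]
      rw [← Real.rpow_add ha]
      push_cast
      ring_nf
    have e2 : w ^ ((2 : ℕ) * (γ / 2 - 1)) * (w ^ 3 * w ^ ((2 : ℕ) * (-(γ + 1) / 2))) = 1 := by
      rw [← Real.rpow_natCast w 3, ← Real.rpow_add hs, ← Real.rpow_add hs]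
      push_cast
      ring_nf
      simp
    rw [e1, mul_assoc, e2, mul_one]
  simp only [hinv v hv]
  rw [mul_left_comm, ← ENNReal.ofReal_mul (abs_nonneg _), hweight,
    ENNReal.ofReal_mul (by positivity), mul_left_comm]

lemma lintegral_one_sub_sq_rpow {a : ℝ} (ha : 0 < a) :
    ∫⁻ v in Set.Ioo (-1 : ℝ) 1, ENNReal.ofReal ((1 - v ^ 2) ^ (a - 1)) =
      ENNReal.ofReal (2 ^ (2 * a - 1) * Gamma a ^ 2 / Gamma (2 * a)) := by
  have himage : (fun t : ℝ => 2 * t + (-1)) '' Set.Ioo 0 1 = Set.Ioo (-1) 1 := by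
    rw [Set.image_affine_Ioo two_pos]
    norm_num
  have hbeta := ProbabilityTheory.beta_pos ha ha
  rw [← himage, lintegral_image_eq_lintegral_abs_deriv_mul measurableSet_Ioo
    (f' := fun _ => 2) (fun t _ => by
      simpa using (((hasDerivAt_id t).const_mul 2).add_const (-1)).hasDerivWithinAt)
    (fun s _ t _ h => by simpa using h)]
  calc
    _ = ∫⁻ t in Set.Ioo (0 : ℝ) 1, ENNReal.ofReal (2 ^ (2 * a - 1) * ProbabilityTheory.beta a a) *
          ENNReal.ofReal (1 / ProbabilityTheory.beta a a * t ^ (a - 1) * (1 - t) ^ (a - 1)) := by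
      refine setLIntegral_congr_fun measurableSet_Ioo fun t ht => ?_
      have h1 : 0 < 1 - t := sub_pos.2 ht.2
      have h2 : 1 - (2 * t + (-1)) ^ 2 = 2 ^ 2 * (t * (1 - t)) := by ring
      have h3 : (2 : ℝ) ^ (2 * a - 1) = 2 * (2 ^ 2) ^ (a - 1) := by
        rw [← Real.rpow_natCast_mul two_pos.le, mul_comm (2 : ℝ) (_ ^ _),
          ← Real.rpow_add_one two_ne_zero]
        push_cast
        ring_nf
      rw [← ENNReal.ofReal_mul (abs_nonneg _), ← ENNReal.ofReal_mul (by positivity), h2,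
        Real.mul_rpow (by positivity) (mul_pos ht.1 h1).le, Real.mul_rpow ht.1.le h1.le, h3,
        abs_of_pos two_pos]
      field_simp
    _ = _ := by
      rw [lintegral_const_mul' _ _ ENNReal.ofReal_ne_top, ← ProbabilityTheory.lintegral_betaPDF,
        ProbabilityTheory.lintegral_betaPDF_eq_one ha ha, mul_one, ProbabilityTheory.beta]
      ring_nf

lemma lintegral_euclideanSpace_three {F : EuclideanSpace ℝ (Fin 3) → ENNReal} (hF : Measurable F) :
    ∫⁻ p, F p = ∫⁻ y : EuclideanSpace ℝ (Fin 2), ∫⁻ x : ℝ,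
      F (WithLp.toLp 2 (Fin.cons x y.ofLp)) := by
  have hsplit := (volume_preserving_piFinSuccAbove (fun _ : Fin 3 => ℝ) 0).symm
  have hmeas : Measurable fun z : ℝ × (Fin 2 → ℝ) =>
      F (WithLp.toLp 2 ((MeasurableEquiv.piFinSuccAbove (fun _ : Fin 3 => ℝ) 0).symm z)) :=
    hF.comp ((PiLp.volume_preserving_toLp (Fin 3)).measurable.comp hsplit.measurable)
  rw [← (PiLp.volume_preserving_toLp (Fin 3)).lintegral_comp hF,
    ← hsplit.lintegral_comp_emb (MeasurableEquiv.measurableEmbedding _),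
    Measure.volume_eq_prod, lintegral_prod_symm' _ hmeas,
    ← (PiLp.volume_preserving_ofLp (Fin 2)).lintegral_comp hmeas.lintegral_prod_left']
  simp [MeasurableEquiv.piFinSuccAbove]
  rfl

/-- The pushforward of the invariant measure under the first velocity component, with the
constant expressed as an integral over the two remaining momentum components. -/
lemma map_velocity_eq (γ : ℝ) :
    (volume.withDensity fun p : EuclideanSpace ℝ (Fin 3) =>
        ENNReal.ofReal ((1 + ‖p‖ ^ 2) ^ (-(γ + 1) / 2))).map
          (fun p => p 0 / √(1 + ‖p‖ ^ 2)) =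
      (∫⁻ y : EuclideanSpace ℝ (Fin 2), ENNReal.ofReal ((1 + ‖y‖ ^ 2) ^ (-γ / 2))) •
        (volume.restrict (Set.Ioo (-1 : ℝ) 1)).withDensity
          (fun v => ENNReal.ofReal ((1 - v ^ 2) ^ (γ / 2 - 1))) := by
  have hvel : Measurable fun p : EuclideanSpace ℝ (Fin 3) => p 0 / √(1 + ‖p‖ ^ 2) := by
    fun_prop
  refine Measure.ext_of_lintegral _ fun g hg => ?_
  have hgvel : Measurable fun p : EuclideanSpace ℝ (Fin 3) => g (p 0 / √(1 + ‖p‖ ^ 2)) :=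
    hg.comp hvel
  rw [lintegral_map hg hvel,
    lintegral_withDensity_eq_lintegral_mul _ (by fun_prop) hgvel,
    lintegral_euclideanSpace_three (by fun_prop), lintegral_smul_measure,
    lintegral_withDensity_eq_lintegral_mul _ (by fun_prop) hg, smul_eq_mul,
    ← lintegral_mul_const _ (by fun_prop)]
  refine lintegral_congr fun y => ?_
  have ha : 0 < √(1 + ‖y‖ ^ 2) := by positivity
  have hnorm : ∀ x : ℝ, 1 + ‖(WithLp.toLp 2 (Fin.cons x y.ofLp) : EuclideanSpace ℝ (Fin 3))‖ ^ 2 =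
      √(1 + ‖y‖ ^ 2) ^ 2 + x ^ 2 := fun x => by
    rw [Real.sq_sqrt (by positivity), EuclideanSpace.norm_sq_eq, EuclideanSpace.norm_sq_eq,
      Fin.sum_univ_succ]
    simp
    ring
  have hpow : √(1 + ‖y‖ ^ 2) ^ (-γ) = (1 + ‖y‖ ^ 2) ^ (-γ / 2) :=
    (Real.rpow_div_two_eq_sqrt _ (by positivity)).symm
  simpa [hnorm, hpow, mul_comm] using lintegral_velocity_eq ha γ g

/-- For `γ > 2`, let `μ` be the measure on `ℝ³` with Lebesgue density
`p ↦ (1+‖p‖²)^{-(γ+1)/2}`. The pushforward of `μ` under `p ↦ p₁/√(1+‖p‖²)` has Lebesgue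
density `C (1-v²)^{γ/2-1} 1_{(-1,1)}(v)` for some `C > 0`, and after normalizing `μ` to a
probability measure the resulting density is the symmetric Beta density
`(Γ(γ)/(2^{γ-1} Γ(γ/2)²)) (1-v²)^{γ/2-1}` on `[-1,1]`. -/
theorem stmt_19 (γ : ℝ) (hγ : 2 < γ) :
    ∃ C : ℝ, 0 < C ∧
      MeasureTheory.Measure.map
          (fun p : EuclideanSpace ℝ (Fin 3) => p 0 / Real.sqrt (1 + ‖p‖ ^ 2))
          (MeasureTheory.volume.withDensity
            (fun p : EuclideanSpace ℝ (Fin 3) =>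
              ENNReal.ofReal ((1 + ‖p‖ ^ 2) ^ (-(γ + 1) / 2)))) =
        MeasureTheory.volume.withDensity
          (fun v : ℝ =>
            ENNReal.ofReal
              (C * Set.indicator (Set.Ioo (-1 : ℝ) 1)
                (fun v : ℝ => (1 - v ^ 2) ^ (γ / 2 - 1)) v)) ∧
      MeasureTheory.Measure.map
          (fun p : EuclideanSpace ℝ (Fin 3) => p 0 / Real.sqrt (1 + ‖p‖ ^ 2))
          (((MeasureTheory.volume.withDensity
                (fun p : EuclideanSpace ℝ (Fin 3) =>
                  ENNReal.ofReal ((1 + ‖p‖ ^ 2) ^ (-(γ + 1) / 2)))) Set.univ)⁻¹ •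
            MeasureTheory.volume.withDensity
              (fun p : EuclideanSpace ℝ (Fin 3) =>
                ENNReal.ofReal ((1 + ‖p‖ ^ 2) ^ (-(γ + 1) / 2)))) =
        MeasureTheory.volume.withDensity
          (fun v : ℝ =>
            ENNReal.ofReal
              (Set.indicator (Set.Icc (-1 : ℝ) 1)
                (fun v : ℝ =>
                  Real.Gamma γ / (2 ^ (γ - 1) * Real.Gamma (γ / 2) ^ 2) *
                    (1 - v ^ 2) ^ (γ / 2 - 1)) v)) := by
  have hIlt : ∫⁻ y : EuclideanSpace ℝ (Fin 2), ENNReal.ofReal ((1 + ‖y‖ ^ 2) ^ (-γ / 2)) ≠ ⊤ :=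
    (integrable_rpow_neg_one_add_norm_sq (μ := volume) (E := EuclideanSpace ℝ (Fin 2))
      (by simpa using hγ)).lintegral_lt_top.ne
  have hIpos : ∫⁻ y : EuclideanSpace ℝ (Fin 2), ENNReal.ofReal ((1 + ‖y‖ ^ 2) ^ (-γ / 2)) ≠ 0 := by
    rw [Ne, lintegral_eq_zero_iff (by fun_prop)]
    intro h
    obtain ⟨y, hy⟩ := h.exists
    exact (ENNReal.ofReal_pos.2 (by positivity)).ne' hy
  have hmap := map_velocity_eq γ
  set I := ∫⁻ y : EuclideanSpace ℝ (Fin 2), ENNReal.ofReal ((1 + ‖y‖ ^ 2) ^ (-γ / 2))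
  set μ : Measure (EuclideanSpace ℝ (Fin 3)) := volume.withDensity fun p =>
    ENNReal.ofReal ((1 + ‖p‖ ^ 2) ^ (-(γ + 1) / 2))
  have hdensity : ∀ c : ℝ, 0 ≤ c →
      ENNReal.ofReal c • (volume.restrict (Set.Ioo (-1 : ℝ) 1)).withDensity
          (fun v => ENNReal.ofReal ((1 - v ^ 2) ^ (γ / 2 - 1))) =
        volume.withDensity fun v => ENNReal.ofReal (c * Set.indicator (Set.Ioo (-1 : ℝ) 1)
          (fun v : ℝ => (1 - v ^ 2) ^ (γ / 2 - 1)) v) := fun c hc => by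
    rw [← withDensity_smul' _ _ ENNReal.ofReal_ne_top, ← withDensity_indicator measurableSet_Ioo]
    congr 1
    ext v
    by_cases hv : v ∈ Set.Ioo (-1 : ℝ) 1
    · simp only [Set.indicator_of_mem hv, Pi.smul_apply, smul_eq_mul, ENNReal.ofReal_mul hc]
    · simp only [Set.indicator_of_notMem hv, mul_zero, ENNReal.ofReal_zero]
  refine ⟨I.toReal, ENNReal.toReal_pos hIpos hIlt, ?_, ?_⟩
  · rw [hmap, ← hdensity _ ENNReal.toReal_nonneg, ENNReal.ofReal_toReal hIlt]
  have hΓ : 0 < Gamma (γ / 2) := Gamma_pos_of_pos (by linarith)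
  have hΓ' : 0 < Gamma γ := Gamma_pos_of_pos (by linarith)
  have hmass : μ Set.univ =
      I * ENNReal.ofReal (2 ^ (γ - 1) * Gamma (γ / 2) ^ 2 / Gamma γ) := by
    have h := congrArg (fun ν : Measure ℝ => ν Set.univ) hmap
    rw [Measure.map_apply (by fun_prop) MeasurableSet.univ, Set.preimage_univ] at h
    rw [h, Measure.smul_apply, withDensity_apply _ MeasurableSet.univ, setLIntegral_univ,
      lintegral_one_sub_sq_rpow (by linarith), smul_eq_mul, mul_div_cancel₀ γ two_ne_zero]
  have hinv : (μ Set.univ)⁻¹ * I =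
      ENNReal.ofReal (Gamma γ / (2 ^ (γ - 1) * Gamma (γ / 2) ^ 2)) := by
    rw [hmass, ENNReal.mul_inv (.inl hIpos) (.inl hIlt), mul_right_comm,
      ENNReal.inv_mul_cancel hIpos hIlt, one_mul, ← ENNReal.ofReal_inv_of_pos (by positivity),
      inv_div]
  rw [Measure.map_smul, hmap, smul_smul, hinv, hdensity _ (by positivity)]
  refine withDensity_congr_ae ?_
  filter_upwards [Ioo_ae_eq_Icc (μ := volume) (a := (-1 : ℝ)) (b := 1)] with v hv
  have hv' : v ∈ Set.Ioo (-1 : ℝ) 1 ↔ v ∈ Set.Icc (-1 : ℝ) 1 := Iff.of_eq hv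
  by_cases h : v ∈ Set.Icc (-1 : ℝ) 1
  · rw [Set.indicator_of_mem h, Set.indicator_of_mem (hv'.2 h)]
  · rw [Set.indicator_of_notMem h, Set.indicator_of_notMem (mt hv'.1 h), mul_zero]
end
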